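/- Uniqueness part of the extension theorem for distributions: let t and s be tempered distributions on ℝⁿ, both with scaling degree at most d < ∞, which agree on all Schwartz functions whose support does not contain 0. Then t − s = Σ_{|α| ≤ d−n} c_α ∂^α δ is a finite linear combination of derivatives of the delta distribution at the origin of order at most d − n; in particular, if d < n then t = s. -/

import Mathlib

open Filter Topology

/-- Dilation of a Schwartz function: `(dilate n lam f) x = f (lam⁻¹ • x)` for
`lam ≠ 0` (and `f` itself for `lam = 0`), i.e. formally `x ↦ f (x / lam)`. -/
noncomputable def dilate (n : ℕ) (lam : ℝ) (f : SchwartzMap (Fin n → ℝ) ℂ) :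
    SchwartzMap (Fin n → ℝ) ℂ :=
  if h : lam = 0 then f
  else
    SchwartzMap.compCLMOfContinuousLinearEquiv ℝ
      ((LinearEquiv.smulOfNeZero ℝ (Fin n → ℝ) lam⁻¹
        (inv_ne_zero h)).toContinuousLinearEquiv) f

/-- The set of candidate scaling degrees `δ` of a tempered distribution `T`
on `ℝⁿ`: those `δ` with `λ^δ · T_λ → 0` weakly as `λ → 0⁺`, where
`⟨T_λ, f⟩ = λ^{-n} ⟨T, f(·/λ)⟩`.  The scaling degree of `T` is the infimum of
this set; `T` has scaling degree at most `d` iff every `δ > d` lies in it. -/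
noncomputable def sdSet (n : ℕ) (T : SchwartzMap (Fin n → ℝ) ℂ →L[ℂ] ℂ) :
    Set ℝ :=
  {δ : ℝ | ∀ f : SchwartzMap (Fin n → ℝ) ℂ,
    Tendsto (fun lam : ℝ =>
        ((lam ^ δ * lam ^ (-(n : ℝ)) : ℝ) : ℂ) * T (dilate n lam f))
      (nhdsWithin 0 (Set.Ioi 0)) (nhds 0)}

/-- The multi-index partial derivative `∂^α f`: for each `j`, differentiate
`α j` times in the `j`-th coordinate direction. -/
noncomputable def mderiv {n : ℕ} (α : Fin n → ℕ) (f : (Fin n → ℝ) → ℂ) :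
    (Fin n → ℝ) → ℂ :=
  (List.finRange n).foldr
    (fun j g => (fun h : (Fin n → ℝ) → ℂ =>
      fun x => fderiv ℝ h x (Pi.single j 1))^[α j] g) f

/-- The finite set of multi-indices `α` with `|α| = Σⱼ αⱼ ≤ r` (empty if
`r < 0`). -/
noncomputable def msIndices (n : ℕ) (r : ℝ) : Finset (Fin n → ℕ) :=
  (Fintype.piFinset fun _ : Fin n => Finset.range (⌊r⌋₊ + 1)).filter
    fun α => ((∑ j, α j : ℕ) : ℝ) ≤ r

open SchwartzMap LineDeriv
open scoped ContDiff

/-- The `j`-th partial derivative as an endomorphism of the Schwartz space. -/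
noncomputable def schwartzPDeriv {n : ℕ} (j : Fin n) :
    Module.End ℂ (SchwartzMap (Fin n → ℝ) ℂ) :=
  (lineDerivOpCLM ℂ (SchwartzMap (Fin n → ℝ) ℂ) (Pi.single j (1 : ℝ) : Fin n → ℝ)).toLinearMap

/-- The multi-index derivative `∂^α` as an endomorphism of the Schwartz space. -/
noncomputable def schwartzMDeriv {n : ℕ} (α : Fin n → ℕ) :
    Module.End ℂ (SchwartzMap (Fin n → ℝ) ℂ) :=
  ((List.finRange n).map fun j => schwartzPDeriv j ^ α j).prod

theorem schwartzPDeriv_apply {n : ℕ} (j : Fin n) (f : SchwartzMap (Fin n → ℝ) ℂ)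
    (x : Fin n → ℝ) :
    schwartzPDeriv j f x = fderiv ℝ f x (Pi.single j 1) := rfl

theorem coe_schwartzMDeriv {n : ℕ} (α : Fin n → ℕ) (f : SchwartzMap (Fin n → ℝ) ℂ) :
    ⇑(schwartzMDeriv α f) = mderiv α ⇑f := by
  unfold schwartzMDeriv mderiv
  have hpow : ∀ (j : Fin n) (k : ℕ) (g : SchwartzMap (Fin n → ℝ) ℂ),
      ⇑((schwartzPDeriv j ^ k) g) = (fun h : (Fin n → ℝ) → ℂ =>
        fun x => fderiv ℝ h x (Pi.single j 1))^[k] ⇑g := by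
    intro j k g
    induction k with
    | zero => rfl
    | succ k ih =>
      rw [pow_succ', Function.iterate_succ_apply', ← ih]
      rfl
  induction List.finRange n with
  | nil => rfl
  | cons j l ih =>
    rw [List.map_cons, List.prod_cons, Module.End.mul_apply, hpow, ih, List.foldr_cons]

theorem commute_schwartzPDeriv {n : ℕ} (i j : Fin n) :
    Commute (schwartzPDeriv i) (schwartzPDeriv j) := by
  have key : ∀ (k l : Fin n) (f : SchwartzMap (Fin n → ℝ) ℂ) (x : Fin n → ℝ),
      schwartzPDeriv k (schwartzPDeriv l f) x =
        fderiv ℝ (fderiv ℝ f) x (Pi.single k 1) (Pi.single l 1) := by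
    intro k l f x
    have hd : DifferentiableAt ℝ (fderiv ℝ f) x :=
      ((f.smooth 2).fderiv_right (m := 1) (by norm_num)).differentiable (by norm_num) x
    have : ⇑(schwartzPDeriv l f) = fun y => fderiv ℝ f y (Pi.single l 1) := rfl
    rw [schwartzPDeriv_apply, this, fderiv_clm_apply hd (differentiableAt_const _)]
    simp
  refine LinearMap.ext fun f => SchwartzMap.ext fun x => ?_
  rw [Module.End.mul_apply, Module.End.mul_apply, key, key]
  exact ((f.smooth 2).contDiffAt.isSymmSndFDerivAt (by simp)).eq _ _

theorem schwartzPDeriv_mul_schwartzMDeriv {n : ℕ} (i : Fin n) (α : Fin n → ℕ) :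
    schwartzPDeriv i * schwartzMDeriv α = schwartzMDeriv (α + Pi.single i 1) := by
  unfold schwartzMDeriv
  have key : ∀ l : List (Fin n), l.Nodup → i ∈ l →
      schwartzPDeriv i * (l.map fun j => schwartzPDeriv j ^ α j).prod =
        (l.map fun j => schwartzPDeriv j ^ (α + Pi.single i 1 : Fin n → ℕ) j).prod := by
    intro l
    induction l with
    | nil => simp
    | cons k l ih =>
      intro hnd hi
      rw [List.nodup_cons] at hnd
      simp only [List.map_cons, List.prod_cons]
      rcases eq_or_ne i k with rfl | hik
      · have hl : (l.map fun j => schwartzPDeriv j ^ (α + Pi.single i 1 : Fin n → ℕ) j) =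
            l.map fun j => schwartzPDeriv j ^ α j := by
          refine List.map_congr_left fun j hj => ?_
          have : j ≠ i := fun h => hnd.1 (h ▸ hj)
          simp [Pi.single_eq_of_ne this]
        rw [hl, ← mul_assoc, Pi.add_apply, Pi.single_eq_same, pow_succ']
      · have hil : i ∈ l := (List.mem_cons.1 hi).resolve_left hik
        rw [← ih hnd.2 hil, Pi.add_apply, Pi.single_eq_of_ne hik.symm, add_zero, ← mul_assoc,
          ((commute_schwartzPDeriv i k).pow_right _).eq, mul_assoc]
  exact key _ (List.nodup_finRange n) (List.mem_finRange i)

/-- Iterated coordinate derivatives are multi-index derivatives. -/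
theorem exists_iteratedLineDerivOp_eq_schwartzMDeriv {n k : ℕ} (v : Fin k → Fin n) :
    ∃ α : Fin n → ℕ, ∑ j, α j = k ∧ ∀ f : SchwartzMap (Fin n → ℝ) ℂ,
      ∂^{fun i => (Pi.single (v i) (1 : ℝ) : Fin n → ℝ)} f = schwartzMDeriv α f := by
  induction k with
  | zero =>
    refine ⟨0, by simp, fun f => ?_⟩
    simp [schwartzMDeriv]
  | succ k ih =>
    obtain ⟨α, hα, h⟩ := ih (fun i => v i.succ)
    refine ⟨α + Pi.single (v 0) 1, by simp [Finset.sum_add_distrib, hα], fun f => ?_⟩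
    rw [iteratedLineDerivOp_succ_left, ← schwartzPDeriv_mul_schwartzMDeriv,
      Module.End.mul_apply, ← h]
    rfl

theorem iteratedFDeriv_zero_eq_zero_of_mderiv {n m : ℕ} (f : SchwartzMap (Fin n → ℝ) ℂ)
    (hf : ∀ α : Fin n → ℕ, ∑ j, α j ≤ m → mderiv α ⇑f 0 = 0) {k : ℕ} (hk : k ≤ m) :
    iteratedFDeriv ℝ k f 0 = 0 := by
  refine ContinuousMultilinearMap.toMultilinearMap_injective ?_
  refine Module.Basis.ext_multilinear (fun _ => Pi.basisFun ℝ (Fin n)) fun v => ?_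
  obtain ⟨α, hα, h⟩ := exists_iteratedLineDerivOp_eq_schwartzMDeriv v
  have h1 := hf α (hα.trans_le hk)
  rw [← coe_schwartzMDeriv, ← h, iteratedLineDerivOp_eq_iteratedFDeriv] at h1
  simpa using h1

theorem dilate_apply {n : ℕ} {lam : ℝ} (hlam : lam ≠ 0) (f : SchwartzMap (Fin n → ℝ) ℂ)
    (x : Fin n → ℝ) : dilate n lam f x = f (lam⁻¹ • x) := by
  simp [dilate, hlam]

theorem schwartzPDeriv_dilate {n : ℕ} {lam : ℝ} (hlam : lam ≠ 0) (j : Fin n)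
    (f : SchwartzMap (Fin n → ℝ) ℂ) :
    schwartzPDeriv j (dilate n lam f) = (lam : ℂ)⁻¹ • dilate n lam (schwartzPDeriv j f) := by
  ext x
  have : ⇑(dilate n lam f) = fun x => f (lam⁻¹ • x) := funext (dilate_apply hlam f)
  rw [schwartzPDeriv_apply, this, fderiv_comp_smul]
  simp [dilate_apply hlam, schwartzPDeriv_apply]

theorem schwartzMDeriv_dilate {n : ℕ} {lam : ℝ} (hlam : lam ≠ 0) (α : Fin n → ℕ)
    (f : SchwartzMap (Fin n → ℝ) ℂ) :
    schwartzMDeriv α (dilate n lam f) =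
      (lam : ℂ)⁻¹ ^ (∑ j, α j) • dilate n lam (schwartzMDeriv α f) := by
  have hpow : ∀ (j : Fin n) (k : ℕ) (g : SchwartzMap (Fin n → ℝ) ℂ),
      (schwartzPDeriv j ^ k) (dilate n lam g) =
        (lam : ℂ)⁻¹ ^ k • dilate n lam ((schwartzPDeriv j ^ k) g) := by
    intro j k g
    induction k with
    | zero => simp
    | succ k ih =>
      rw [pow_succ', Module.End.mul_apply, ih, map_smul, schwartzPDeriv_dilate hlam, smul_smul,
        ← pow_succ]
      rfl
  rw [← List.sum_ofFn, List.ofFn_eq_map]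
  unfold schwartzMDeriv
  induction List.finRange n with
  | nil => simp
  | cons j l ih =>
    simp only [List.map_cons, List.prod_cons, List.sum_cons, Module.End.mul_apply]
    rw [ih, map_smul, hpow, smul_smul, ← pow_add, add_comm]

theorem mderiv_dilate_zero {n : ℕ} {lam : ℝ} (hlam : lam ≠ 0) (α : Fin n → ℕ)
    (f : SchwartzMap (Fin n → ℝ) ℂ) :
    mderiv α ⇑(dilate n lam f) 0 = (lam : ℂ)⁻¹ ^ (∑ j, α j) * mderiv α ⇑f 0 := by
  rw [← coe_schwartzMDeriv, schwartzMDeriv_dilate hlam, ← coe_schwartzMDeriv]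
  simp [dilate_apply hlam]

theorem mem_msIndices {n : ℕ} {r : ℝ} {α : Fin n → ℕ} :
    α ∈ msIndices n r ↔ ((∑ j, α j : ℕ) : ℝ) ≤ r := by
  simp only [msIndices, Finset.mem_filter, Fintype.mem_piFinset, Finset.mem_range,
    Nat.lt_succ_iff, and_iff_right_iff_imp]
  intro h j
  refine Nat.le_floor (le_trans ?_ h)
  exact_mod_cast Finset.single_le_sum (f := α) (fun _ _ => Nat.zero_le _) (Finset.mem_univ j)

/-- If `lam ^ ρ * ∑ a k * lam⁻ᵏ → 0` as `lam → 0⁺` for all `ρ > r`, then `a k = 0` for `k > r`. -/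
theorem eq_zero_of_tendsto_rpow_mul_sum (a : ℕ → ℂ) (r : ℝ) (N : ℕ)
    (h : ∀ ρ : ℝ, r < ρ → Tendsto (fun lam : ℝ =>
      ((lam ^ ρ : ℝ) : ℂ) * ∑ k ∈ Finset.range N, (lam : ℂ)⁻¹ ^ k * a k) (𝓝[>] 0) (𝓝 0))
    {k : ℕ} (hkN : k < N) (hk : r < k) : a k = 0 := by
  induction N with
  | zero => omega
  | succ N ih =>
    have hN : a N = 0 := by
      have hrN : r < N := hk.trans_le (by exact_mod_cast Nat.lt_succ_iff.1 hkN)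
      have hc : Tendsto (fun lam : ℝ => ∑ k ∈ Finset.range (N + 1), (lam : ℂ) ^ (N - k) * a k)
          (𝓝[>] 0) (𝓝 (∑ k ∈ Finset.range (N + 1), ((0 : ℝ) : ℂ) ^ (N - k) * a k)) := by
        refine (Continuous.tendsto ?_ (0 : ℝ)).mono_left nhdsWithin_le_nhds
        fun_prop
      have hz : ∑ k ∈ Finset.range (N + 1), ((0 : ℝ) : ℂ) ^ (N - k) * a k = a N := by
        rw [Finset.sum_range_succ, Finset.sum_eq_zero]
        · simp
        · intro j hj
          have : N - j ≠ 0 := by have := Finset.mem_range.1 hj; omega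
          simp [this]
      rw [hz] at hc
      refine tendsto_nhds_unique hc ((h N hrN).congr' ?_)
      filter_upwards [self_mem_nhdsWithin] with lam hlam
      have hlam0 : (lam : ℂ) ≠ 0 := by exact_mod_cast (ne_of_gt hlam)
      rw [Finset.mul_sum]
      refine Finset.sum_congr rfl fun j hj => ?_
      have hj' : j ≤ N := Nat.lt_succ_iff.1 (Finset.mem_range.1 hj)
      rw [Real.rpow_natCast, pow_sub₀ _ hlam0 hj', Complex.ofReal_pow, inv_pow, mul_assoc]
    rcases (Nat.lt_succ_iff.1 hkN).eq_or_lt with rfl | hlt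
    · exact hN
    · refine ih (fun ρ hρ => ?_) hlt
      simpa [Finset.sum_range_succ, hN] using h ρ hρ

/-- Taylor estimate: if all derivatives of order at most `m` vanish at `0`, the `k`-th derivative
is `O(‖x‖ ^ (m + 1 - k))`. -/
theorem norm_iteratedFDeriv_le_of_iteratedFDeriv_zero_eq_zero {E F : Type*}
    [NormedAddCommGroup E] [NormedSpace ℝ E] [NormedAddCommGroup F] [NormedSpace ℝ F]
    {f : E → F} {m : ℕ} {A : ℝ} (hf : ContDiff ℝ (m + 1 : ℕ) f)
    (hA : ∀ x, ‖iteratedFDeriv ℝ (m + 1) f x‖ ≤ A)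
    (h0 : ∀ k ≤ m, iteratedFDeriv ℝ k f 0 = 0) {k : ℕ} (hk : k ≤ m + 1) (x : E) :
    ‖iteratedFDeriv ℝ k f x‖ ≤ A * ‖x‖ ^ (m + 1 - k) := by
  have hA0 : 0 ≤ A := (norm_nonneg _).trans (hA 0)
  induction hk using Nat.decreasingInduction generalizing x with
  | self => simpa using hA x
  | of_succ k hk ih =>
    have hd : Differentiable ℝ (iteratedFDeriv ℝ k f) :=
      hf.differentiable_iteratedFDeriv (by exact_mod_cast hk)
    have := (convex_closedBall (0 : E) ‖x‖).norm_image_sub_le_of_norm_fderiv_le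
      (f := iteratedFDeriv ℝ k f) (C := A * ‖x‖ ^ (m + 1 - (k + 1)))
      (fun y _ => hd y) (fun y hy => ?_) (Metric.mem_closedBall_self (norm_nonneg x))
      (y := x) (by simp)
    · rw [h0 k (Nat.lt_succ_iff.1 hk), sub_zero, sub_zero, mul_assoc, ← pow_succ] at this
      rwa [show m + 1 - k = m + 1 - (k + 1) + 1 by omega]
    · rw [norm_fderiv_iteratedFDeriv]
      refine (ih y).trans ?_
      have : ‖y‖ ≤ ‖x‖ := by simpa using hy
      gcongr

theorem coe_smulLeftCLM_contDiffBump {E : Type*} [NormedAddCommGroup E] [NormedSpace ℝ E]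
    [FiniteDimensional ℝ E] (χ : ContDiffBump (0 : E)) (f : SchwartzMap E ℂ) {ε : ℝ}
    (hε : 0 < ε) :
    ⇑(smulLeftCLM ℂ (fun x => χ (ε⁻¹ • x)) f) = fun x => χ (ε⁻¹ • x) • f x :=
  smulLeftCLM_apply ((χ.hasCompactSupport.comp_smul (inv_ne_zero hε.ne')).hasTemperateGrowth
    (χ.contDiff.comp (contDiff_const_smul _))) f

/-- If the derivatives of `f` of order at most `m` vanish at `0`, the Schwartz seminorms of order
at most `m` of the cut-off of `f` at scale `ε` are `O(ε)`. -/
theorem exists_seminorm_smulLeftCLM_contDiffBump_le {E : Type*} [NormedAddCommGroup E]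
    [NormedSpace ℝ E] [FiniteDimensional ℝ E] (χ : ContDiffBump (0 : E)) (f : SchwartzMap E ℂ)
    {m : ℕ} (hf : ∀ k ≤ m, iteratedFDeriv ℝ k f 0 = 0) (k : ℕ) {l : ℕ} (hl : l ≤ m) :
    ∃ M : ℝ, 0 ≤ M ∧ ∀ ε : ℝ, 0 < ε → ε ≤ 1 →
      SchwartzMap.seminorm ℂ k l (smulLeftCLM ℂ (fun x => χ (ε⁻¹ • x)) f) ≤ M * ε := by
  obtain ⟨A, hA⟩ : ∃ A : ℝ, ∀ x, ‖iteratedFDeriv ℝ (m + 1) f x‖ ≤ A :=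
    ⟨_, fun x => f.norm_iteratedFDeriv_le_seminorm ℝ _ x⟩
  have hA0 : 0 ≤ A := (norm_nonneg _).trans (hA 0)
  have hfA : ∀ k ≤ m + 1, ∀ x, ‖iteratedFDeriv ℝ k f x‖ ≤ A * ‖x‖ ^ (m + 1 - k) :=
    fun k hk x => norm_iteratedFDeriv_le_of_iteratedFDeriv_zero_eq_zero (f.smooth _) hA hf hk x
  have hB : ∀ i, ∃ B : ℝ, ∀ x, ‖iteratedFDeriv ℝ i χ x‖ ≤ B := fun i =>
    ⟨_, fun x => (χ.hasCompactSupport.toSchwartzMap χ.contDiff).norm_iteratedFDeriv_le_seminorm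
      ℝ i x⟩
  choose B hB using hB
  have hB0 : ∀ i, 0 ≤ B i := fun i => (norm_nonneg _).trans (hB i 0)
  obtain ⟨R, hR⟩ : ∃ R, R = χ.rOut := ⟨_, rfl⟩
  have hR0 : 0 < R := hR ▸ χ.rOut_pos
  have hM : 0 ≤ ∑ i ∈ Finset.range (l + 1),
      (l.choose i : ℝ) * B i * (A * R ^ (m + 1 - (l - i))) := Finset.sum_nonneg fun i _ =>
    mul_nonneg (mul_nonneg (Nat.cast_nonneg _) (hB0 i)) (by positivity)
  refine ⟨R ^ k * ∑ i ∈ Finset.range (l + 1),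
    (l.choose i : ℝ) * B i * (A * R ^ (m + 1 - (l - i))),
    mul_nonneg (by positivity) hM, fun ε hε hε1 => ?_⟩
  have hg := coe_smulLeftCLM_contDiffBump χ f hε
  generalize smulLeftCLM ℂ (fun x => χ (ε⁻¹ • x)) f = g at hg ⊢
  refine SchwartzMap.seminorm_le_bound ℂ k l _
    (mul_nonneg (mul_nonneg (by positivity) hM) hε.le) fun x => ?_
  by_cases hx : x ∈ tsupport g
  · have hxε : ‖x‖ ≤ R * ε := by
      have hcl : IsClosed {y : E | ‖y‖ ≤ R * ε} := isClosed_le continuous_norm continuous_const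
      refine closure_minimal (fun y hy => ?_) hcl hx
      by_contra hlt
      simp only [Set.mem_ofPred_eq, not_le] at hlt
      refine hy ?_
      have : χ (ε⁻¹ • y) = 0 := by
        refine χ.zero_of_le_dist ?_
        rw [dist_zero_right, norm_smul, norm_inv, Real.norm_of_nonneg hε.le,
          inv_mul_eq_div, le_div_iff₀ hε, ← hR]
        exact hlt.le
      simp [hg, this]
    have hxR : ‖x‖ ≤ R := hxε.trans (mul_le_of_le_one_right hR0.le hε1)
    have hder := norm_iteratedFDeriv_smul_le (𝕜 := ℝ) (N := l)
      (χ.contDiff.comp (contDiff_const_smul ε⁻¹)) (f.smooth l) x le_rfl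
    rw [hg, mul_assoc, Finset.sum_mul]
    refine mul_le_mul (pow_le_pow_left₀ (norm_nonneg _) hxR k) (hder.trans ?_)
      (norm_nonneg _) (by positivity)
    refine Finset.sum_le_sum fun i hi => ?_
    have hil : i ≤ l := Nat.lt_succ_iff.1 (Finset.mem_range.1 hi)
    have h1 : ‖iteratedFDeriv ℝ i (fun x => χ (ε⁻¹ • x)) x‖ ≤ ε⁻¹ ^ i * B i := by
      rw [iteratedFDeriv_comp_const_smul ε⁻¹ (χ.contDiff (n := i)), norm_smul, norm_pow,
        norm_inv, Real.norm_of_nonneg hε.le]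
      exact mul_le_mul_of_nonneg_left (hB i _) (by positivity)
    have h2 : ‖iteratedFDeriv ℝ (l - i) f x‖ ≤ A * (R * ε) ^ (m + 1 - (l - i)) :=
      (hfA _ (by omega) x).trans (by gcongr)
    have hBi := hB0 i
    calc (l.choose i : ℝ) * ‖iteratedFDeriv ℝ i (fun x => χ (ε⁻¹ • x)) x‖ *
          ‖iteratedFDeriv ℝ (l - i) f x‖
        ≤ (l.choose i : ℝ) * (ε⁻¹ ^ i * B i) * (A * (R * ε) ^ (m + 1 - (l - i))) := by
          gcongr
      _ = (l.choose i : ℝ) * B i * (A * R ^ (m + 1 - (l - i))) * ε ^ (m - l + 1) := by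
          have hεi : ε⁻¹ ^ i * ε ^ i = 1 := by rw [← mul_pow, inv_mul_cancel₀ hε.ne', one_pow]
          have hexp : ε ^ (m + 1 - (l - i)) = ε ^ i * ε ^ (m - l + 1) := by
            rw [← pow_add]
            congr 1
            omega
          rw [mul_pow, hexp]
          linear_combination ((l.choose i : ℝ) * B i * A * R ^ (m + 1 - (l - i)) *
            ε ^ (m - l + 1)) * hεi
      _ ≤ (l.choose i : ℝ) * B i * (A * R ^ (m + 1 - (l - i))) * ε :=
          mul_le_mul_of_nonneg_left (pow_le_of_le_one hε.le hε1 (by omega)) (by positivity)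
  · have : iteratedFDeriv ℝ l g x = 0 := by
      by_contra h
      exact hx (support_iteratedFDeriv_subset l h)
    rw [this, norm_zero, mul_zero]
    exact mul_nonneg (mul_nonneg (by positivity) hM) hε.le

/-- A continuous functional on Schwartz space vanishing on functions supported away from `0`
has finite order at `0`: it kills the functions whose derivatives at `0` vanish up to some
order. -/
theorem exists_order_of_eq_zero_of_zero_notMem_tsupport {E : Type*}
    [NormedAddCommGroup E] [NormedSpace ℝ E] [FiniteDimensional ℝ E]
    (u : SchwartzMap E ℂ →L[ℂ] ℂ)
    (hu : ∀ f : SchwartzMap E ℂ, (0 : E) ∉ tsupport ⇑f → u f = 0) :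
    ∃ m₀ : ℕ, ∀ m ≥ m₀, ∀ f : SchwartzMap E ℂ,
      (∀ k ≤ m, iteratedFDeriv ℝ k f 0 = 0) → u f = 0 := by
  obtain ⟨s, C, -, hC⟩ := Seminorm.bound_of_continuous (schwartz_withSeminorms ℂ E ℂ)
    ((normSeminorm ℂ ℂ).comp u.toLinearMap) (by exact u.continuous.norm)
  refine ⟨s.sup Prod.snd, fun m hm f hf => ?_⟩
  let χ : ContDiffBump (0 : E) := ⟨1, 2, one_pos, one_lt_two⟩
  have hgu : ∀ ε : ℝ, 0 < ε → u f = u (smulLeftCLM ℂ (fun x => χ (ε⁻¹ • x)) f) := by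
    intro ε hε
    rw [← sub_eq_zero, ← map_sub]
    refine hu _ ?_
    rw [notMem_tsupport_iff_eventuallyEq]
    have h1 : Tendsto (fun x : E => ε⁻¹ • x) (𝓝 0) (𝓝 0) :=
      (continuous_const_smul ε⁻¹).tendsto' _ _ (smul_zero _)
    filter_upwards [h1.eventually χ.eventuallyEq_one] with x hx
    rw [sub_apply, coe_smulLeftCLM_contDiffBump χ f hε]
    simp [hx]
  have hbound := fun k l (hl : l ≤ m) =>
    exists_seminorm_smulLeftCLM_contDiffBump_le χ f hf k hl
  choose! M hM0 hM using hbound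
  have hsm : ∀ i ∈ s, i.2 ≤ m := fun i hi => (Finset.le_sup (f := Prod.snd) hi).trans hm
  have hM' : ∀ i ∈ s, 0 ≤ M i.1 i.2 := fun i hi => hM0 _ _ (hsm i hi)
  have hle : ∀ ε : ℝ, 0 < ε → ε ≤ 1 → ‖u f‖ ≤ C * ((∑ i ∈ s, M i.1 i.2) * ε) := by
    intro ε hε hε1
    rw [hgu ε hε]
    refine (hC _).trans ?_
    change (C : ℝ) * _ ≤ _
    refine mul_le_mul_of_nonneg_left ?_ C.2
    refine Seminorm.finset_sup_apply_le (mul_nonneg (Finset.sum_nonneg hM') hε.le) fun i hi => ?_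
    refine (hM i.1 i.2 (hsm i hi) ε hε hε1).trans (mul_le_mul_of_nonneg_right ?_ hε.le)
    exact Finset.single_le_sum (f := fun i : ℕ × ℕ => M i.1 i.2) hM' hi
  have hlim : Tendsto (fun ε : ℝ => (C : ℝ) * ((∑ i ∈ s, M i.1 i.2) * ε)) (𝓝[>] 0) (𝓝 0) := by
    refine Tendsto.mono_left ?_ nhdsWithin_le_nhds
    exact Continuous.tendsto' (by fun_prop) _ _ (by simp)
  have : ‖u f‖ ≤ 0 := by
    refine ge_of_tendsto hlim ?_
    filter_upwards [Ioc_mem_nhdsGT (zero_lt_one' ℝ)] with ε hε using hle ε hε.1 hε.2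
  exact norm_le_zero_iff.1 this

/-- A distribution supported at the origin is a finite linear combination of the functionals
`f ↦ ∂^α f(0)`, where the order bound `m` may be taken arbitrarily large. -/
theorem exists_eq_sum_mderiv_of_eq_zero_of_zero_notMem_tsupport {n : ℕ}
    (u : SchwartzMap (Fin n → ℝ) ℂ →L[ℂ] ℂ)
    (hu : ∀ f : SchwartzMap (Fin n → ℝ) ℂ, (0 : Fin n → ℝ) ∉ tsupport ⇑f → u f = 0) (m₁ : ℕ) :
    ∃ m ≥ m₁, ∃ c : (Fin n → ℕ) → ℂ, ∀ f : SchwartzMap (Fin n → ℝ) ℂ,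
      u f = ∑ α ∈ msIndices n m, c α * mderiv α ⇑f 0 := by
  obtain ⟨m₀, hm₀⟩ := exists_order_of_eq_zero_of_zero_notMem_tsupport u hu
  refine ⟨max m₀ m₁, le_max_right _ _, ?_⟩
  set m := max m₀ m₁
  let ℓ : msIndices n m → SchwartzMap (Fin n → ℝ) ℂ →ₗ[ℂ] ℂ := fun α =>
    { toFun := fun f => schwartzMDeriv α.1 f 0
      map_add' := fun f g => by simp
      map_smul' := fun c f => by simp }
  have hℓ : ∀ α f, ℓ α f = mderiv α.1 ⇑f 0 := fun α f => by rw [← coe_schwartzMDeriv]; rfl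
  have hspan : (u : SchwartzMap (Fin n → ℝ) ℂ →ₗ[ℂ] ℂ) ∈ Submodule.span ℂ (Set.range ℓ) := by
    refine mem_span_of_iInf_ker_le_ker fun f hf => ?_
    simp only [Submodule.mem_iInf, LinearMap.mem_ker, hℓ] at hf
    refine hm₀ m (le_max_left _ _) f fun k hk => iteratedFDeriv_zero_eq_zero_of_mderiv f
      (fun α hα => hf ⟨α, mem_msIndices.2 (by exact_mod_cast hα)⟩) hk
  obtain ⟨c, hc⟩ := (Submodule.mem_span_range_iff_exists_fun ℂ).1 hspan
  refine ⟨fun α => if h : α ∈ msIndices n m then c ⟨α, h⟩ else 0, fun f => ?_⟩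
  rw [← Finset.sum_coe_sort]
  have h1 := LinearMap.congr_fun hc f
  simp only [LinearMap.sum_apply, LinearMap.smul_apply, hℓ, smul_eq_mul] at h1
  simpa using h1.symm

/-- The homogeneous parts of degree larger than `r` of a combination of derivatives at `0`
vanish if the scaling degree is at most `n + r`. -/
theorem sum_filter_mderiv_eq_zero_of_tendsto {n m : ℕ} (c : (Fin n → ℕ) → ℂ) (r : ℝ)
    (f : SchwartzMap (Fin n → ℝ) ℂ)
    (h : ∀ ρ : ℝ, r < ρ → Tendsto (fun lam : ℝ => ((lam ^ ρ : ℝ) : ℂ) *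
      ∑ α ∈ msIndices n m, c α * mderiv α ⇑(dilate n lam f) 0) (𝓝[>] 0) (𝓝 0)) :
    ∑ α ∈ msIndices n m with ¬ ((∑ j, α j : ℕ) : ℝ) ≤ r, c α * mderiv α ⇑f 0 = 0 := by
  let S := msIndices n m
  let a : ℕ → ℂ := fun k => ∑ α ∈ S with ∑ j, α j = k, c α * mderiv α ⇑f 0
  have hS : ∀ α ∈ S, ∑ j, α j ∈ Finset.range (m + 1) := fun α hα =>
    Finset.mem_range.2 (Nat.lt_succ_iff.2 (by exact_mod_cast mem_msIndices.1 hα))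
  have ha : ∀ k < m + 1, r < k → a k = 0 := by
    intro k hkm hrk
    refine eq_zero_of_tendsto_rpow_mul_sum a r (m + 1) (fun ρ hρ => (h ρ hρ).congr' ?_) hkm hrk
    filter_upwards [self_mem_nhdsWithin] with lam hlam
    congr 1
    rw [← Finset.sum_fiberwise_of_maps_to hS]
    refine Finset.sum_congr rfl fun k _ => ?_
    rw [Finset.mul_sum]
    refine Finset.sum_congr rfl fun α hα => ?_
    rw [mderiv_dilate_zero (ne_of_gt hlam), (Finset.mem_filter.1 hα).2]
    ring
  rw [← Finset.sum_fiberwise_of_maps_to (t := Finset.range (m + 1)) (g := fun α => ∑ j, α j)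
    fun α hα => hS α (Finset.mem_filter.1 hα).1]
  refine Finset.sum_eq_zero fun k hk => ?_
  by_cases hkr : (k : ℝ) ≤ r
  · rw [Finset.sum_eq_zero]
    intro α hα
    simp only [Finset.mem_filter] at hα
    exact absurd (hα.2 ▸ hkr) hα.1.2
  · rw [← ha k (Finset.mem_range.1 hk) (not_le.1 hkr), Finset.filter_filter]
    refine Finset.sum_congr (Finset.filter_congr fun α _ => ?_) fun _ _ => rfl
    exact and_iff_right_of_imp fun h => h ▸ hkr

/-- **Uniqueness part of the extension theorem for distributions.** If two
tempered distributions `t`, `s` on `ℝⁿ` both have scaling degree at most `d`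
and agree on all Schwartz functions supported away from the origin, then
`t − s = Σ_{|α| ≤ d−n} c_α ∂^α δ` is a finite linear combination of
derivatives of the Dirac distribution at `0` of order at most `d − n`
(where `⟨∂^α δ, f⟩ = (−1)^{|α|} ∂^α f(0)`); in particular `t = s` if `d < n`. -/
theorem extension_of_distribution_unique (n : ℕ)
    (t s : SchwartzMap (Fin n → ℝ) ℂ →L[ℂ] ℂ) (d : ℝ)
    (ht : ∀ δ : ℝ, d < δ → δ ∈ sdSet n t)
    (hs : ∀ δ : ℝ, d < δ → δ ∈ sdSet n s)
    (hagree : ∀ f : SchwartzMap (Fin n → ℝ) ℂ,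
      (0 : Fin n → ℝ) ∉ tsupport ⇑f → t f = s f) :
    (∃ c : (Fin n → ℕ) → ℂ,
      ∀ f : SchwartzMap (Fin n → ℝ) ℂ,
        t f - s f = ∑ α ∈ msIndices n (d - n),
          c α * ((-1 : ℂ) ^ (∑ j, α j) * mderiv α (⇑f) 0)) ∧
    (d < n → t = s) := by
  have hsum : ∃ c : (Fin n → ℕ) → ℂ, ∀ f : SchwartzMap (Fin n → ℝ) ℂ,
      t f - s f = ∑ α ∈ msIndices n (d - n),
        c α * ((-1 : ℂ) ^ (∑ j, α j) * mderiv α (⇑f) 0) := by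
    obtain ⟨m, hm, c, hc⟩ := exists_eq_sum_mderiv_of_eq_zero_of_zero_notMem_tsupport (t - s)
      (fun f hf => by simp [hagree f hf]) ⌊d - n⌋₊
    refine ⟨fun α => (-1 : ℂ) ^ (∑ j, α j) * c α, fun f => ?_⟩
    have hhigh := sum_filter_mderiv_eq_zero_of_tendsto (m := m) c (d - n) f fun ρ hρ => by
      have hδ : d < ρ + n := by linarith
      have hts := (ht _ hδ f).sub (hs _ hδ f)
      rw [sub_zero] at hts
      refine hts.congr' ?_
      filter_upwards [self_mem_nhdsWithin] with lam hlam
      rw [← hc, ← Real.rpow_add hlam, add_neg_cancel_right, ← mul_sub]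
      rfl
    have hlow : {α ∈ msIndices n m | ((∑ j, α j : ℕ) : ℝ) ≤ d - n} = msIndices n (d - n) := by
      ext α
      simp only [Finset.mem_filter, mem_msIndices, and_iff_right_iff_imp]
      exact fun h => by exact_mod_cast (Nat.le_floor h).trans hm
    have hf := hc f
    rw [← Finset.sum_filter_add_sum_filter_not _
      (fun α : Fin n → ℕ => ((∑ j, α j : ℕ) : ℝ) ≤ d - n), hhigh, add_zero, hlow] at hf
    refine Eq.trans hf (Finset.sum_congr rfl fun α _ => ?_)
    have hsign : ((-1 : ℂ) ^ (∑ j, α j)) * (-1 : ℂ) ^ (∑ j, α j) = 1 := by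
      rw [← mul_pow]; simp
    linear_combination (-(c α * mderiv α (⇑f) 0)) * hsign
  refine ⟨hsum, fun hd => ?_⟩
  obtain ⟨c, hc⟩ := hsum
  ext f
  rw [← sub_eq_zero, hc f]
  refine Finset.sum_eq_zero fun α hα => ?_
  have h1 := mem_msIndices.1 hα
  have h2 : (0 : ℝ) ≤ ((∑ j, α j : ℕ) : ℝ) := Nat.cast_nonneg _
  linarith
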